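/- arXiv:2503.03086 — 4 statements merged into one kernel-verified Lean document; each statement's English description precedes it below -/
import Mathlib

section
/- Let a : ℕ → ℝ with a_n > 0 for all n and b : ℕ → ℂ. The adjoint of the maximal Jacobi operator satisfies J(a,b)* = J(a,b*) if and only if W_{+∞}(u,v) = lim_{n→∞} W_n(u,v) = 0 for all u, v in the domain D(J(a,b)). -/
open scoped InnerProductSpace ComplexConjugate

noncomputable section

/-- The Hilbert space `ℓ²(ℕ₀)` of square-summable complex sequences. -/
abbrev H : Type := lp (fun _ : ℕ => ℂ) 2

/-- The formal Jacobi action: `(Ju)ₙ = aₙ₋₁uₙ₋₁ + bₙuₙ + aₙuₙ₊₁` (with `u₋₁ = 0`). -/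
def jacobiAct (a : ℕ → ℝ) (b : ℕ → ℂ) (u : ℕ → ℂ) : ℕ → ℂ := fun n =>
  (if n = 0 then 0 else (a (n - 1) : ℂ) * u (n - 1)) + b n * u n + (a n : ℂ) * u (n + 1)

lemma jacobiAct_add (a : ℕ → ℝ) (b : ℕ → ℂ) (u v : ℕ → ℂ) :
    jacobiAct a b (u + v) = jacobiAct a b u + jacobiAct a b v := by
  funext n
  by_cases h : n = 0 <;> simp [jacobiAct, h] <;> ring

lemma jacobiAct_smul (a : ℕ → ℝ) (b : ℕ → ℂ) (c : ℂ) (u : ℕ → ℂ) :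
    jacobiAct a b (c • u) = c • jacobiAct a b u := by
  funext n
  by_cases h : n = 0 <;> simp [jacobiAct, h] <;> ring

lemma jacobiAct_zero (a : ℕ → ℝ) (b : ℕ → ℂ) : jacobiAct a b 0 = 0 := by
  funext n
  by_cases h : n = 0 <;> simp [jacobiAct, h]

/-- The domain of the maximal Jacobi operator: all `u ∈ ℓ²` whose formal Jacobi action is
again in `ℓ²`. -/
def jacobiDomain (a : ℕ → ℝ) (b : ℕ → ℂ) : Submodule ℂ H where
  carrier := {u : H | Memℓp (jacobiAct a b ⇑u) 2}
  zero_mem' := by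
    have h := zero_memℓp (E := fun _ : ℕ => ℂ) (p := 2)
    rw [← jacobiAct_zero a b] at h
    exact h
  add_mem' := by
    intro u v hu hv
    have h := Memℓp.add hu hv
    rw [← jacobiAct_add] at h
    exact h
  smul_mem' := by
    intro c u hu
    simpa [lp.coeFn_smul, jacobiAct_smul] using hu.const_smul c

/-- The maximal Jacobi operator `J(a,b)`, as a partially defined linear operator on
`ℓ²(ℕ₀)`. -/
def jacobiOp (a : ℕ → ℝ) (b : ℕ → ℂ) : H →ₗ.[ℂ] H where
  domain := jacobiDomain a b
  toFun :=
    { toFun := fun u => (⟨jacobiAct a b ⇑(u : H), u.2⟩ : H)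
      map_add' := by
        intro u v
        apply Subtype.ext
        exact jacobiAct_add a b _ _
      map_smul' := by
        intro c u
        apply Subtype.ext
        exact jacobiAct_smul a b c _ }

/-- The subspace `ℓ²_c(ℕ₀)` of finitely supported sequences. -/
def finSupp : Submodule ℂ H where
  carrier := {u : H | (Function.support ⇑u).Finite}
  zero_mem' := by simp [Function.support]
  add_mem' := by
    intro u v hu hv
    refine Set.Finite.subset (hu.union hv) ?_
    intro n hn
    simp only [Function.mem_support, lp.coeFn_add, Pi.add_apply] at hn
    by_contra hc
    simp only [Set.mem_union, Function.mem_support, not_or, not_not] at hc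
    exact hn (by rw [hc.1, hc.2, add_zero])
  smul_mem' := by
    intro c u hu
    refine Set.Finite.subset hu ?_
    intro n hn
    simp only [Function.mem_support, lp.coeFn_smul, Pi.smul_apply, smul_eq_mul] at hn
    simp only [Function.mem_support]
    intro h
    exact hn (by rw [h, mul_zero])

lemma finSupp_memℓp (a : ℕ → ℝ) (b : ℕ → ℂ) (u : ℕ → ℂ)
    (hu : (Function.support u).Finite) : Memℓp (jacobiAct a b u) 2 := by
  have hfin : (((· + 1) '' Function.support u ∪ Function.support u) ∪
      ((· - 1) '' Function.support u)).Finite :=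
    ((hu.image _).union hu).union (hu.image _)
  refine (memℓp_zero (hfin.subset ?_)).of_exponent_ge zero_le
  intro n hn
  simp only [Set.mem_setOf_eq, jacobiAct] at hn
  by_contra hc
  simp only [Set.mem_union, Set.mem_image, Function.mem_support, not_or, not_exists,
    not_and] at hc
  obtain ⟨⟨h1, h2⟩, h3⟩ := hc
  have e2 : u n = 0 := not_not.1 h2
  have e3 : u (n + 1) = 0 := by
    by_contra hne
    exact h3 (n + 1) hne (by omega)
  apply hn
  by_cases h : n = 0
  · subst h; simp [e2, show u 1 = 0 from e3]
  · have e1 : u (n - 1) = 0 := by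
      by_contra hne
      exact h1 (n - 1) hne (by omega)
    simp [h, e1, e2, e3]

/-- The minimal Jacobi operator `J₀(a,b)`: the restriction of the maximal operator to the
finitely supported sequences. -/
def jacobiOp₀ (a : ℕ → ℝ) (b : ℕ → ℂ) : H →ₗ.[ℂ] H where
  domain := finSupp
  toFun :=
    { toFun := fun u => (⟨jacobiAct a b ⇑(u : H), finSupp_memℓp a b _ u.2⟩ : H)
      map_add' := by
        intro u v
        apply Subtype.ext
        exact jacobiAct_add a b _ _
      map_smul' := by
        intro c u
        apply Subtype.ext
        exact jacobiAct_smul a b c _ }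

/-- The Wronskian `Wₙ(u,v) = aₙ(uₙ₊₁vₙ − uₙvₙ₊₁)`. -/
def wronskian (a : ℕ → ℝ) (u v : ℕ → ℂ) (n : ℕ) : ℂ :=
  (a n : ℂ) * (u (n + 1) * v n - u n * v (n + 1))

/-- Green's formula on a finite segment. -/
lemma sum_range_jacobiAct_sub (a : ℕ → ℝ) (b u v : ℕ → ℂ) (n : ℕ) :
    ∑ k ∈ Finset.range (n + 1), (jacobiAct a b u k * v k - u k * jacobiAct a b v k) =
      wronskian a u v n := by
  induction n with
  | zero => simp [jacobiAct, wronskian]; ring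
  | succ n ih =>
    rw [Finset.sum_range_succ, ih]
    simp [jacobiAct, wronskian]
    ring

lemma jacobiAct_conj_star (a : ℕ → ℝ) (b u : ℕ → ℂ) :
    jacobiAct a (fun n => conj (b n)) (star u) = star (jacobiAct a b u) := by
  funext n
  by_cases h : n = 0 <;> simp [jacobiAct, h]

lemma star_mem_jacobiDomain {a : ℕ → ℝ} {b : ℕ → ℂ} {u : H} (hu : u ∈ jacobiDomain a b) :
    star u ∈ jacobiDomain a (fun n => conj (b n)) := by
  change Memℓp (jacobiAct a _ ⇑(star u)) 2
  rw [lp.coeFn_star, jacobiAct_conj_star]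
  exact Memℓp.star_mem hu

lemma star_mem_jacobiDomain_of_conj {a : ℕ → ℝ} {b : ℕ → ℂ} {u : H}
    (hu : u ∈ jacobiDomain a (fun n => conj (b n))) : star u ∈ jacobiDomain a b := by
  simpa using star_mem_jacobiDomain hu

lemma jacobiOp_conj_star (a : ℕ → ℝ) (b : ℕ → ℂ) (u : (jacobiOp a b).domain) :
    jacobiOp a (fun n => conj (b n)) ⟨star (u : H), star_mem_jacobiDomain u.2⟩ =
      star (jacobiOp a b u) :=
  Subtype.ext (jacobiAct_conj_star a b ⇑(u : H))

lemma coe_jacobiOp (a : ℕ → ℝ) (b : ℕ → ℂ) (u : (jacobiOp a b).domain) :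
    ⇑(jacobiOp a b u) = jacobiAct a b ⇑(u : H) :=
  rfl

/-- Green's formula at infinity. -/
lemma tendsto_wronskian (a : ℕ → ℝ) (b : ℕ → ℂ) (u v : (jacobiOp a b).domain) :
    Filter.Tendsto (fun n => wronskian a (⇑(u : H)) (⇑(v : H)) n) Filter.atTop
      (nhds (⟪star (v : H), jacobiOp a b u⟫_ℂ - ⟪star (jacobiOp a b v), (u : H)⟫_ℂ)) := by
  have h := ((lp.hasSum_inner (𝕜 := ℂ) (star (v : H)) (jacobiOp a b u)).sub
    (lp.hasSum_inner (𝕜 := ℂ) (star (jacobiOp a b v)) (u : H))).tendsto_sum_nat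
  refine (h.comp (Filter.tendsto_add_atTop_nat 1)).congr fun n => ?_
  rw [← sum_range_jacobiAct_sub a b]
  refine Finset.sum_congr rfl fun k _ => ?_
  simp [RCLike.inner_apply, coe_jacobiOp]

lemma isFormalAdjoint_jacobiOp_iff (a : ℕ → ℝ) (b : ℕ → ℂ) :
    (jacobiOp a (fun n => conj (b n))).IsFormalAdjoint (jacobiOp a b) ↔
      ∀ u v : (jacobiOp a b).domain,
        Filter.Tendsto (fun n => wronskian a (⇑(u : H)) (⇑(v : H)) n)
          Filter.atTop (nhds 0) := by
  constructor
  · intro h u v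
    have hW := tendsto_wronskian a b u v
    rwa [← jacobiOp_conj_star, h, sub_self] at hW
  · intro h x u
    have hx : star (x : H) ∈ (jacobiOp a b).domain := star_mem_jacobiDomain_of_conj x.2
    have hW := tendsto_nhds_unique (tendsto_wronskian a b u ⟨star (x : H), hx⟩) (h u ⟨_, hx⟩)
    rw [← jacobiOp_conj_star] at hW
    simp only [star_star] at hW
    exact (sub_eq_zero.1 hW).symm

lemma single_mem_jacobiDomain (a : ℕ → ℝ) (b : ℕ → ℂ) (n : ℕ) :
    (lp.single 2 n 1 : H) ∈ jacobiDomain a b := by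
  refine finSupp_memℓp a b _ ((Set.finite_singleton n).subset ?_)
  rw [lp.coeFn_single]
  exact Pi.support_single_subset

lemma dense_jacobiOp_domain (a : ℕ → ℝ) (b : ℕ → ℂ) :
    Dense ((jacobiOp a b).domain : Set H) := by
  rw [Submodule.dense_iff_topologicalClosure_eq_top, Submodule.topologicalClosure_eq_top_iff,
    Submodule.eq_bot_iff]
  intro y hy
  ext n
  simpa [lp.inner_single_left] using hy _ (single_mem_jacobiDomain a b n)

lemma inner_jacobiOp_single (a : ℕ → ℝ) (b : ℕ → ℂ) (y : H) (n : ℕ) :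
    ⟪jacobiOp a b ⟨lp.single 2 n 1, single_mem_jacobiDomain a b n⟩, y⟫_ℂ =
      jacobiAct a (fun n => conj (b n)) ⇑y n := by
  have hJ : jacobiOp a b ⟨lp.single 2 n 1, single_mem_jacobiDomain a b n⟩ =
      lp.single 2 (n - 1) (if n = 0 then 0 else (a (n - 1) : ℂ)) + lp.single 2 n (b n) +
        lp.single 2 (n + 1) (a n : ℂ) := by
    ext k
    change jacobiAct a b (Pi.single n 1) k =
      (Pi.single (n - 1) (if n = 0 then 0 else (a (n - 1) : ℂ)) : ℕ → ℂ) k +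
        (Pi.single n (b n) : ℕ → ℂ) k + (Pi.single (n + 1) (a n : ℂ) : ℕ → ℂ) k
    rcases n with _ | n <;> rcases k with _ | k <;>
      simp [jacobiAct, Pi.single_apply] <;> grind
  rw [hJ]
  rcases n with _ | n <;>
    simp [lp.inner_single_left, jacobiAct, mul_comm]

lemma adjoint_jacobiOp_le (a : ℕ → ℝ) (b : ℕ → ℂ) :
    (jacobiOp a b).adjoint ≤ jacobiOp a (fun n => conj (b n)) := by
  have hact (y : (jacobiOp a b).adjoint.domain) :
      ⇑((jacobiOp a b).adjoint y) = jacobiAct a (fun n => conj (b n)) ⇑(y : H) := by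
    funext n
    have h := (LinearPMap.adjoint_isFormalAdjoint (dense_jacobiOp_domain a b)).symm
      ⟨_, single_mem_jacobiDomain a b n⟩ y
    rw [inner_jacobiOp_single, lp.inner_single_left] at h
    simpa using h.symm
  refine ⟨fun y hy => ?_, fun x y hxy => Subtype.ext ?_⟩
  · change Memℓp _ 2
    rw [← hact ⟨y, hy⟩]
    exact lp.memℓp _
  · rw [hact, hxy]
    rfl

/-- **Characterization of `J(a,b)* = J(a,b*)` via vanishing of Wronskian limits**:
the adjoint of the maximal Jacobi operator equals the maximal operator with conjugated
diagonal iff `W₊∞(u,v) = 0` for all `u, v` in the maximal domain. -/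
theorem adjoint_jacobiOp_iff_wronskian (a : ℕ → ℝ) (ha : ∀ n, 0 < a n) (b : ℕ → ℂ) :
    (jacobiOp a b).adjoint = jacobiOp a (fun n => conj (b n)) ↔
      ∀ u v : (jacobiOp a b).domain,
        Filter.Tendsto (fun n => wronskian a (⇑(u : H)) (⇑(v : H)) n)
          Filter.atTop (nhds 0) := by
  rw [← isFormalAdjoint_jacobiOp_iff]
  constructor
  · intro h
    rw [← h]
    exact LinearPMap.adjoint_isFormalAdjoint (dense_jacobiOp_domain a b)
  · intro h
    exact le_antisymm (adjoint_jacobiOp_le a b)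
      (h.symm.le_adjoint (dense_jacobiOp_domain a b))

end
end

section
/- Let μ be a finite positive Borel measure on ℝ with ∫ |x|^n dμ(x) < ∞ for some n ∈ ℕ, and let g : ℝ → ℂ be Borel measurable with |g(x)| ≤ 1 for all x. Then for every α ∈ (0, π/2] and every z ∈ ℂ with arg(z) ∈ [α, π − α], one has |∫ g(x)/(x − z) dμ(x) + Σ_{j=0}^{n−1} z^{−j−1} ∫ x^j g(x) dμ(x)| ≤ |z|^{−n−1} (sin α)^{−1} ∫ |x|^n dμ(x). -/
open MeasureTheory Real

/-- The sine is at least `sin α` on `[α, π - α]`. -/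
theorem sin_le_sin_of_mem_Icc {α θ : ℝ} (hα : 0 ≤ α) (hθ : θ ∈ Set.Icc α (π - α)) :
    Real.sin α ≤ Real.sin θ := by
  obtain ⟨h1, h2⟩ := hθ
  rcases le_total θ (π / 2) with h | h
  · exact Real.sin_le_sin_of_le_of_le_pi_div_two (by linarith [Real.pi_pos]) h h1
  · rw [← Real.sin_pi_sub θ]
    exact Real.sin_le_sin_of_le_of_le_pi_div_two (by linarith [Real.pi_pos]) (by linarith)
      (by linarith)

/-- Points of the sector `arg z ∈ [α, π - α]` are at distance at least `‖z‖ sin α` from the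
real line. -/
theorem norm_mul_sin_le_norm_ofReal_sub {α : ℝ} (hα : 0 ≤ α) {z : ℂ}
    (hz : z.arg ∈ Set.Icc α (π - α)) (x : ℝ) : ‖z‖ * Real.sin α ≤ ‖(x : ℂ) - z‖ :=
  calc ‖z‖ * Real.sin α ≤ ‖z‖ * Real.sin z.arg := by
        gcongr
        exact sin_le_sin_of_mem_Icc hα hz
    _ = z.im := Complex.norm_mul_sin_arg z
    _ ≤ |((x : ℂ) - z).im| := by simpa using le_abs_self z.im
    _ ≤ ‖(x : ℂ) - z‖ := Complex.abs_im_le_norm _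

/-- The finite geometric expansion of `(x - z)⁻¹` in powers of `x / z`. -/
theorem inv_sub_add_sum_zpow_mul_pow {K : Type*} [Field K] {x z : K} (hz : z ≠ 0) (hxz : x - z ≠ 0)
    (n : ℕ) :
    (x - z)⁻¹ + ∑ j ∈ Finset.range n, z ^ (-(j : ℤ) - 1) * x ^ j =
      x ^ n * (z ^ n)⁻¹ * (x - z)⁻¹ := by
  induction n with
  | zero => simp
  | succ k ih =>
    have h : z ^ (-(k : ℤ) - 1) = (z ^ (k + 1))⁻¹ := by
      rw [← zpow_natCast, ← zpow_neg]
      congr 1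
      push_cast
      ring
    rw [Finset.sum_range_succ, ← add_assoc, ih, h]
    field_simp
    ring

/-- On a finite measure space, a finite absolute moment bounds all lower ones, also against a
bounded weight. -/
theorem integrable_ofReal_pow_mul_of_norm_le_one {μ : Measure ℝ} [IsFiniteMeasure μ] {n j : ℕ}
    (hmom : Integrable (fun x => |x| ^ n) μ) (hj : j ≤ n) {g : ℝ → ℂ} (hg : Measurable g)
    (hg1 : ∀ x, ‖g x‖ ≤ 1) : Integrable (fun x : ℝ => (x : ℂ) ^ j * g x) μ := by
  refine ((integrable_const (1 : ℝ)).add hmom).mono' (by fun_prop) (.of_forall fun x => ?_)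
  have hpow : |x| ^ j ≤ 1 + |x| ^ n := by
    rcases le_total |x| 1 with h | h
    · linarith [pow_le_one₀ (n := j) (abs_nonneg x) h, pow_nonneg (abs_nonneg x) n]
    · linarith [pow_le_pow_right₀ h hj]
  calc ‖(x : ℂ) ^ j * g x‖ = |x| ^ j * ‖g x‖ := by simp
    _ ≤ |x| ^ j := mul_le_of_le_one_right (by positivity) (hg1 x)
    _ ≤ 1 + |x| ^ n := hpow

/-- **Nontangential asymptotic expansion of a weighted Stieltjes transform.**
If `μ` is a finite positive Borel measure on `ℝ` with `∫ |x|^n dμ < ∞` and `g` is Borel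
with `|g| ≤ 1`, then for `α ∈ (0, π/2]` and `z` in the sector `arg z ∈ [α, π − α]`,
`|∫ g(x)/(x − z) dμ + Σ_{j<n} z^{−j−1} ∫ x^j g(x) dμ| ≤ |z|^{−n−1} (sin α)⁻¹ ∫ |x|^n dμ`. -/
theorem stieltjes_transform_expansion
    (μ : Measure ℝ) [IsFiniteMeasure μ] (n : ℕ)
    (hmom : Integrable (fun x => |x| ^ n) μ)
    (g : ℝ → ℂ) (hg : Measurable g) (hg1 : ∀ x, ‖g x‖ ≤ 1)
    (α : ℝ) (hα : α ∈ Set.Ioc 0 (π / 2))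
    (z : ℂ) (hz : z.arg ∈ Set.Icc α (π - α)) :
    ‖(∫ x, g x / ((x : ℂ) - z) ∂μ) +
        ∑ j ∈ Finset.range n, z ^ (-(j : ℤ) - 1) * ∫ x, (x : ℂ) ^ j * g x ∂μ‖ ≤
      ‖z‖ ^ (-(n : ℤ) - 1) * (Real.sin α)⁻¹ * ∫ x, |x| ^ n ∂μ := by
  obtain ⟨hα0, hα1⟩ := hα
  have hsin : 0 < Real.sin α := Real.sin_pos_of_pos_of_lt_pi hα0 (by linarith [Real.pi_pos])
  have hz0 : z ≠ 0 := by
    rintro rfl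
    rw [Complex.arg_zero] at hz
    exact hα0.not_ge hz.1
  have hzpos : 0 < ‖z‖ := norm_pos_iff.mpr hz0
  have hdist := norm_mul_sin_le_norm_ofReal_sub hα0.le hz
  have hxz (x : ℝ) : (x : ℂ) - z ≠ 0 :=
    norm_pos_iff.mp ((mul_pos hzpos hsin).trans_le (hdist x))
  have hinv (x : ℝ) : ‖(x : ℂ) - z‖⁻¹ ≤ (‖z‖ * Real.sin α)⁻¹ :=
    inv_anti₀ (mul_pos hzpos hsin) (hdist x)
  have hint : Integrable (fun x : ℝ => g x / ((x : ℂ) - z)) μ := by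
    refine (integrable_const (‖z‖ * Real.sin α)⁻¹).mono'
      (hg.div (by fun_prop)).aestronglyMeasurable (.of_forall fun x => ?_)
    rw [norm_div, div_eq_mul_inv]
    exact (mul_le_of_le_one_left (by positivity) (hg1 x)).trans (hinv x)
  have hterm : ∀ j ∈ Finset.range n,
      Integrable (fun x : ℝ => z ^ (-(j : ℤ) - 1) * ((x : ℂ) ^ j * g x)) μ := fun j hj =>
    (integrable_ofReal_pow_mul_of_norm_le_one hmom (Finset.mem_range.mp hj).le hg hg1).const_mul _
  simp_rw [← integral_const_mul]
  rw [← integral_finsetSum _ hterm, ← integral_add hint (integrable_finsetSum _ hterm)]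
  refine norm_integral_le_of_norm_le (hmom.const_mul _) (.of_forall fun x => ?_)
  have hremainder : g x / ((x : ℂ) - z) +
      ∑ j ∈ Finset.range n, z ^ (-(j : ℤ) - 1) * ((x : ℂ) ^ j * g x) =
      (x : ℂ) ^ n * (z ^ n)⁻¹ * ((x : ℂ) - z)⁻¹ * g x := by
    rw [← inv_sub_add_sum_zpow_mul_pow hz0 (hxz x) n, add_mul, Finset.sum_mul, div_eq_inv_mul]
    simp_rw [mul_assoc]
  have hzpow : ‖z‖ ^ (-(n : ℤ) - 1) = (‖z‖ ^ n)⁻¹ * ‖z‖⁻¹ := by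
    rw [zpow_sub_one₀ hzpos.ne', zpow_neg, zpow_natCast]
  rw [hremainder]
  calc ‖(x : ℂ) ^ n * (z ^ n)⁻¹ * ((x : ℂ) - z)⁻¹ * g x‖
      = |x| ^ n * (‖z‖ ^ n)⁻¹ * ‖(x : ℂ) - z‖⁻¹ * ‖g x‖ := by simp
    _ ≤ |x| ^ n * (‖z‖ ^ n)⁻¹ * (‖z‖ * Real.sin α)⁻¹ * 1 := by
        gcongr
        · exact hdist x
        · exact hg1 x
    _ = ‖z‖ ^ (-(n : ℤ) - 1) * (Real.sin α)⁻¹ * |x| ^ n := by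
        rw [hzpow, mul_inv]
        ring
end

section
/- Let ρ be a finite positive Borel measure on ℝ and W : ℝ → M₂(ℂ) a Borel function such that W(x) is positive semidefinite with trace 1 for ρ-a.e. x and ∫_ℝ W(x) dρ(x) = I. Define F(z) = ∫ W(x)/(x − z) dρ(x) (entrywise) for z ∈ ℂ \ ℝ, and assume F(z)₀₀ = F(z)₁₁, F(−z)₀₀ = −F(z)₀₀, F(−z)₀₁ = F(z)₀₁ and F(−z)₁₀ = F(z)₁₀ for all z ∈ ℂ \ ℝ. Then: (i) W(x)₀₀ = W(x)₁₁ = 1/2 for ρ-a.e. x; (ii) |W(x)₀₁| ≤ 1/2 for ρ-a.e. x; (iii) the measure (1/2)ρ is an even probability measure on ℝ; and (iv) the complex measure W₀₁ dρ is odd, i.e. ∫_{−B} W₀₁ dρ = −∫_B W₀₁ dρ for every Borel set B ⊆ ℝ. -/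
open MeasureTheory ComplexConjugate ENNReal
open scoped ComplexOrder

/-- The dilated, unnormalised Poisson kernel `c / (1 + (c u)²)`. -/
noncomputable def dilatedCauchyKernel (c u : ℝ) : ℝ := c * (1 + (c * u) ^ 2)⁻¹

lemma continuous_dilatedCauchyKernel (c : ℝ) : Continuous (dilatedCauchyKernel c) := by
  unfold dilatedCauchyKernel
  refine continuous_const.mul (Continuous.inv₀ (by fun_prop) fun u => ?_)
  positivity

lemma norm_dilatedCauchyKernel_le (c u : ℝ) : ‖dilatedCauchyKernel c u‖ ≤ |c| := by
  have h : (1 + (c * u) ^ 2)⁻¹ ≤ 1 := inv_le_one_of_one_le₀ (by nlinarith [sq_nonneg (c * u)])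
  have h0 : 0 ≤ (1 + (c * u) ^ 2)⁻¹ := by positivity
  rw [dilatedCauchyKernel, norm_mul, Real.norm_eq_abs, Real.norm_eq_abs, abs_of_nonneg h0]
  exact mul_le_of_le_one_right (abs_nonneg c) h

/-- The Poisson kernel is the jump of the resolvent across the real axis. -/
lemma inv_sub_sub_inv_sub_eq_dilatedCauchyKernel {c : ℝ} (hc : 0 < c) (x t : ℝ) :
    ((x : ℂ) - (t + (c⁻¹ : ℝ) * Complex.I))⁻¹ - ((x : ℂ) - (t - (c⁻¹ : ℝ) * Complex.I))⁻¹ =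
      2 * Complex.I * (dilatedCauchyKernel c (x - t) : ℂ) := by
  have hc' : (c : ℂ) ≠ 0 := by exact_mod_cast hc.ne'
  have h1 : (x : ℂ) - (t + (c⁻¹ : ℝ) * Complex.I) ≠ 0 := by
    intro h
    have := congrArg Complex.im h
    simp at this
    exact hc.ne' this
  have h2 : (x : ℂ) - (t - (c⁻¹ : ℝ) * Complex.I) ≠ 0 := by
    intro h
    have := congrArg Complex.im h
    simp at this
    exact hc.ne' this
  have h3 : (1 + ((c : ℂ) * (x - t)) ^ 2) ≠ 0 := by
    have : (1 + (c * (x - t)) ^ 2) ≠ 0 := by positivity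
    exact_mod_cast this
  have h4 : ((x : ℂ) - (t + (c⁻¹ : ℝ) * Complex.I)) * ((x : ℂ) - (t - (c⁻¹ : ℝ) * Complex.I)) =
      (1 + ((c : ℂ) * (x - t)) ^ 2) / (c : ℂ) ^ 2 := by
    push_cast
    field_simp
    linear_combination -Complex.I_sq
  rw [inv_sub_inv h1 h2, h4, dilatedCauchyKernel]
  push_cast
  field_simp
  ring

lemma integral_dilatedCauchyKernel_mul {c : ℝ} (hc : 0 < c) (g : ℝ → ℂ) (x : ℝ) :
    ∫ t, (dilatedCauchyKernel c (x - t) : ℂ) * g t =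
      ∫ s, (((1 + s ^ 2)⁻¹ : ℝ) : ℂ) * g (x - c⁻¹ * s) := by
  have h1 := integral_sub_left_eq_self
    (fun u => (dilatedCauchyKernel c u : ℂ) * g (x - u)) volume x
  have h2 := Measure.integral_comp_mul_left
    (fun s => (c : ℂ) * ((((1 + s ^ 2)⁻¹ : ℝ) : ℂ) * g (x - c⁻¹ * s))) c
  have h0 : ∀ t, x - (x - t) = t := sub_sub_cancel x
  beta_reduce at h1
  simp only [h0] at h1
  rw [h1]
  have h3 : ∀ u : ℝ, (dilatedCauchyKernel c u : ℂ) * g (x - u) =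
      (c : ℂ) * ((((1 + (c * u) ^ 2)⁻¹ : ℝ) : ℂ) * g (x - c⁻¹ * (c * u))) := fun u => by
    rw [inv_mul_cancel_left₀ hc.ne', dilatedCauchyKernel]
    push_cast
    ring
  simp only [h3]
  rw [h2, integral_const_mul, abs_of_pos (inv_pos.2 hc), Complex.real_smul]
  have hc' : (c : ℂ) ≠ 0 := by exact_mod_cast hc.ne'
  push_cast
  rw [inv_mul_cancel_left₀ hc']

lemma norm_integral_cauchyKernel_mul_le {g : ℝ → ℂ} {C : ℝ} (hC : ∀ x, ‖g x‖ ≤ C)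
    (v : ℝ → ℝ) : ‖∫ s, (((1 + s ^ 2)⁻¹ : ℝ) : ℂ) * g (v s)‖ ≤ Real.pi * C := by
  rw [← integral_univ_inv_one_add_sq, ← integral_mul_const]
  refine norm_integral_le_of_norm_le (integrable_inv_one_add_sq.mul_const C) (.of_forall fun s => ?_)
  rw [norm_mul, Complex.norm_real, Real.norm_of_nonneg (by positivity)]
  exact mul_le_mul_of_nonneg_left (hC _) (by positivity)

lemma tendsto_integral_cauchyKernel_mul {g : ℝ → ℂ} (hg : Continuous g) {C : ℝ}
    (hC : ∀ x, ‖g x‖ ≤ C) (x : ℝ) :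
    Filter.Tendsto (fun c : ℝ => ∫ s, (((1 + s ^ 2)⁻¹ : ℝ) : ℂ) * g (x - c⁻¹ * s))
      Filter.atTop (nhds (Real.pi * g x)) := by
  have hlim : (Real.pi : ℂ) * g x = ∫ s : ℝ, (((1 + s ^ 2)⁻¹ : ℝ) : ℂ) * g x := by
    rw [integral_mul_const, integral_complex_ofReal, integral_univ_inv_one_add_sq]
  have hcont : Continuous fun s : ℝ => (((1 + s ^ 2)⁻¹ : ℝ) : ℂ) :=
    Complex.continuous_ofReal.comp
      (Continuous.inv₀ (by fun_prop) fun s => by positivity)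
  rw [hlim]
  refine tendsto_integral_filter_of_dominated_convergence (fun s => (1 + s ^ 2)⁻¹ * C)
    (.of_forall fun c => ?_) (.of_forall fun c => .of_forall fun s => ?_)
    (integrable_inv_one_add_sq.mul_const C) (.of_forall fun s => ?_)
  · exact (hcont.mul (hg.comp (by fun_prop))).aestronglyMeasurable
  · rw [norm_mul, Complex.norm_real, Real.norm_of_nonneg (by positivity)]
    exact mul_le_mul_of_nonneg_left (hC _) (by positivity)
  · refine Filter.Tendsto.const_mul _ ((hg.tendsto x).comp ?_)
    simpa using (tendsto_const_nhds (x := x)).sub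
      ((tendsto_inv_atTop_zero (𝕜 := ℝ)).mul_const s)

/-- Poisson smoothing of `f dμ`, tested against `g`, converges to `π ∫ f g dμ`. -/
lemma tendsto_integral_mul_poissonSmoothing {μ : Measure ℝ} [IsFiniteMeasure μ]
    {f g : ℝ → ℂ} (hf : Integrable f μ) (hg : Continuous g) (hgs : HasCompactSupport g) :
    Filter.Tendsto
      (fun c : ℝ => ∫ t, g t * ∫ x, f x * (dilatedCauchyKernel c (x - t) : ℂ) ∂μ)
      Filter.atTop (nhds (∫ x, f x * (Real.pi * g x) ∂μ)) := by
  obtain ⟨C, hC⟩ := hgs.exists_bound_of_continuous hg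
  have hswap : ∀ c : ℝ, 0 < c →
      ∫ t, g t * ∫ x, f x * (dilatedCauchyKernel c (x - t) : ℂ) ∂μ =
        ∫ x, f x * (∫ s, (((1 + s ^ 2)⁻¹ : ℝ) : ℂ) * g (x - c⁻¹ * s)) ∂μ := by
    intro c hc
    have hint : Integrable (Function.uncurry fun t x =>
        (dilatedCauchyKernel c (x - t) : ℂ) * (g t * f x)) (volume.prod μ) := by
      refine Integrable.bdd_mul (c := |c|)
        ((hg.integrable_of_hasCompactSupport hgs).mul_prod hf) ?_ (.of_forall fun p => ?_)
      · exact (Complex.continuous_ofReal.comp ((continuous_dilatedCauchyKernel c).comp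
          (continuous_snd.sub continuous_fst))).aestronglyMeasurable
      · rw [Complex.norm_real]
        exact norm_dilatedCauchyKernel_le _ _
    calc ∫ t, g t * ∫ x, f x * (dilatedCauchyKernel c (x - t) : ℂ) ∂μ
        = ∫ t, ∫ x, (dilatedCauchyKernel c (x - t) : ℂ) * (g t * f x) ∂μ := by
          refine integral_congr_ae (.of_forall fun t => ?_)
          simp only [← integral_const_mul]
          exact integral_congr_ae (.of_forall fun x => by ring)
      _ = ∫ x, (∫ t, (dilatedCauchyKernel c (x - t) : ℂ) * (g t * f x)) ∂μ :=
          integral_integral_swap hint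
      _ = _ := by
          refine integral_congr_ae (.of_forall fun x => ?_)
          simp only [← integral_dilatedCauchyKernel_mul hc, ← integral_const_mul]
          exact integral_congr_ae (.of_forall fun t => by ring)
  have hmain : Filter.Tendsto
      (fun c : ℝ => ∫ x, f x * (∫ s, (((1 + s ^ 2)⁻¹ : ℝ) : ℂ) * g (x - c⁻¹ * s)) ∂μ)
      Filter.atTop (nhds (∫ x, f x * (Real.pi * g x) ∂μ)) := by
    refine tendsto_integral_filter_of_dominated_convergence (fun x => ‖f x‖ * (Real.pi * C))
      (.of_forall fun c => ?_) (.of_forall fun c => .of_forall fun x => ?_)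
      (hf.norm.mul_const _) (.of_forall fun x => ?_)
    · refine hf.aestronglyMeasurable.mul
        (StronglyMeasurable.integral_prod_right
          (f := fun x s : ℝ => (((1 + s ^ 2)⁻¹ : ℝ) : ℂ) * g (x - c⁻¹ * s)) ?_).aestronglyMeasurable
      refine Continuous.stronglyMeasurable (Continuous.mul (Complex.continuous_ofReal.comp
        (Continuous.inv₀ (by fun_prop) fun p => by positivity)) (hg.comp (by fun_prop)))
    · rw [norm_mul]
      exact mul_le_mul_of_nonneg_left (norm_integral_cauchyKernel_mul_le hC _) (norm_nonneg _)
    · exact (tendsto_integral_cauchyKernel_mul hg hC x).const_mul _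
  refine hmain.congr' ?_
  filter_upwards [Filter.eventually_gt_atTop 0] with c hc using (hswap c hc).symm

lemma integrable_div_sub {μ : Measure ℝ} {f : ℝ → ℂ} (hf : Integrable f μ) {z : ℂ}
    (hz : z.im ≠ 0) : Integrable (fun x : ℝ => f x / ((x : ℂ) - z)) μ := by
  have hne : ∀ x : ℝ, (x : ℂ) - z ≠ 0 := fun x h => hz (by simpa using congrArg Complex.im h)
  simp only [div_eq_mul_inv]
  refine Integrable.mul_bdd (c := |z.im|⁻¹) hf
    (Continuous.inv₀ (by fun_prop) hne).aestronglyMeasurable (.of_forall fun x => ?_)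
  rw [norm_inv]
  refine inv_anti₀ (abs_pos.2 hz) ?_
  simpa using Complex.abs_im_le_norm ((x : ℂ) - z)

lemma integral_mul_dilatedCauchyKernel {μ : Measure ℝ} {f : ℝ → ℂ} (hf : Integrable f μ)
    {c : ℝ} (hc : 0 < c) (t : ℝ) :
    ∫ x, f x * (dilatedCauchyKernel c (x - t) : ℂ) ∂μ =
      (2 * Complex.I)⁻¹ * (∫ x : ℝ, f x / ((x : ℂ) - (t + (c⁻¹ : ℝ) * Complex.I)) ∂μ -
        ∫ x : ℝ, f x / ((x : ℂ) - (t - (c⁻¹ : ℝ) * Complex.I)) ∂μ) := by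
  rw [← integral_sub (integrable_div_sub hf (by simp [hc.ne']))
    (integrable_div_sub hf (by simp [hc.ne'])), ← integral_const_mul]
  refine integral_congr_ae (.of_forall fun x => ?_)
  simp only [div_eq_mul_inv]
  rw [← mul_sub, inv_sub_sub_inv_sub_eq_dilatedCauchyKernel hc]
  have : (2 * Complex.I) ≠ 0 := by simp
  field_simp

/-- Two complex measures `f₁ dμ₁` and `f₂ dμ₂` with the same Stieltjes transform off the real
axis have the same integrals against compactly supported continuous functions. -/
lemma integral_mul_eq_of_stieltjes_eq {μ₁ μ₂ : Measure ℝ} [IsFiniteMeasure μ₁]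
    [IsFiniteMeasure μ₂] {f₁ f₂ : ℝ → ℂ} (hf₁ : Integrable f₁ μ₁) (hf₂ : Integrable f₂ μ₂)
    (h : ∀ z : ℂ, z.im ≠ 0 →
      ∫ x, f₁ x / ((x : ℂ) - z) ∂μ₁ = ∫ x, f₂ x / ((x : ℂ) - z) ∂μ₂)
    {g : ℝ → ℂ} (hg : Continuous g) (hgs : HasCompactSupport g) :
    ∫ x, f₁ x * g x ∂μ₁ = ∫ x, f₂ x * g x ∂μ₂ := by
  have h1 := tendsto_integral_mul_poissonSmoothing hf₁ hg hgs
  have h2 := tendsto_integral_mul_poissonSmoothing hf₂ hg hgs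
  have key := tendsto_nhds_unique (h1.congr' ?_) h2
  · simp only [mul_left_comm _ (Real.pi : ℂ), integral_const_mul] at key
    exact mul_left_cancel₀ (by exact_mod_cast Real.pi_ne_zero) key
  · filter_upwards [Filter.eventually_gt_atTop 0] with c hc
    refine integral_congr_ae (.of_forall fun t => ?_)
    simp only [integral_mul_dilatedCauchyKernel hf₁ hc, integral_mul_dilatedCauchyKernel hf₂ hc]
    rw [h _ (by simp [hc.ne']), h _ (by simp [hc.ne'])]

/-- An integrable density is determined a.e. by its Stieltjes transform. -/
lemma ae_eq_of_stieltjes_eq {μ : Measure ℝ} [IsFiniteMeasure μ] {f₁ f₂ : ℝ → ℂ}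
    (hf₁ : Integrable f₁ μ) (hf₂ : Integrable f₂ μ)
    (h : ∀ z : ℂ, z.im ≠ 0 →
      ∫ x, f₁ x / ((x : ℂ) - z) ∂μ = ∫ x, f₂ x / ((x : ℂ) - z) ∂μ) :
    ∀ᵐ x ∂μ, f₁ x = f₂ x := by
  have h0 := ae_eq_zero_of_integral_contDiff_smul_eq_zero (hf₁.sub hf₂).locallyIntegrable
    fun g hg hgs => ?_
  · filter_upwards [h0] with x hx using sub_eq_zero.1 hx
  · have hgc : Continuous fun x => (g x : ℂ) := Complex.continuous_ofReal.comp hg.continuous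
    have hgs' : HasCompactSupport fun x => (g x : ℂ) :=
      hgs.comp_left (g := ((↑) : ℝ → ℂ)) Complex.ofReal_zero
    obtain ⟨C, hC⟩ := hgs'.exists_bound_of_continuous hgc
    have hi : ∀ {f : ℝ → ℂ}, Integrable f μ → Integrable (fun x => f x * (g x : ℂ)) μ :=
      fun hf => hf.mul_bdd hgc.aestronglyMeasurable (.of_forall hC)
    have heq := integral_mul_eq_of_stieltjes_eq hf₁ hf₂ h hgc hgs'
    rw [← sub_eq_zero, ← integral_sub (hi hf₁) (hi hf₂)] at heq
    rw [← heq]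
    refine integral_congr_ae (.of_forall fun x => ?_)
    simp only [Pi.sub_apply, Complex.real_smul]
    ring

/-- A finite measure on `ℝ` is determined by its Stieltjes transform. -/
lemma measure_eq_of_stieltjes_eq {μ₁ μ₂ : Measure ℝ} [IsFiniteMeasure μ₁] [IsFiniteMeasure μ₂]
    (h : ∀ z : ℂ, z.im ≠ 0 →
      ∫ x : ℝ, 1 / ((x : ℂ) - z) ∂μ₁ = ∫ x : ℝ, 1 / ((x : ℂ) - z) ∂μ₂) : μ₁ = μ₂ := by
  refine Measure.ext_of_integral_eq_on_compactlySupported fun g => ?_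
  have heq := integral_mul_eq_of_stieltjes_eq (integrable_const (1 : ℂ))
    (integrable_const (1 : ℂ)) h (g := fun x => (g x : ℂ))
    (Complex.continuous_ofReal.comp g.continuous)
    (g.hasCompactSupport.comp_left (g := ((↑) : ℝ → ℂ)) Complex.ofReal_zero)
  simp only [one_mul, integral_complex_ofReal] at heq
  exact_mod_cast heq

lemma norm_apply_zero_one_le_half {A : Matrix (Fin 2) (Fin 2) ℂ} (hA : A.PosSemidef)
    (h0 : A 0 0 = 1 / 2) (h1 : A 1 1 = 1 / 2) : ‖A 0 1‖ ≤ 1 / 2 := by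
  have hdet := hA.det_nonneg
  have h10 : A 1 0 = conj (A 0 1) := (hA.isHermitian.apply 1 0).symm
  rw [Matrix.det_fin_two, h0, h1, h10, Complex.mul_conj, Complex.normSq_eq_norm_sq] at hdet
  have hre : (0 : ℝ) ≤ 1 / 2 * (1 / 2) - ‖A 0 1‖ ^ 2 := by
    rw [← Complex.zero_le_real]
    push_cast
    simpa using hdet
  nlinarith [norm_nonneg (A 0 1)]

/-- A finite measure with odd Stieltjes transform is even. -/
lemma map_neg_eq_of_stieltjes_odd {μ : Measure ℝ} [IsFiniteMeasure μ]
    (h : ∀ z : ℂ, z.im ≠ 0 →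
      ∫ x : ℝ, 1 / ((x : ℂ) - -z) ∂μ = -∫ x : ℝ, 1 / ((x : ℂ) - z) ∂μ) :
    μ.map (fun x => -x) = μ := by
  refine measure_eq_of_stieltjes_eq fun z hz => ?_
  rw [integral_map measurable_neg.aemeasurable
    (by fun_prop : Measurable fun x : ℝ => 1 / ((x : ℂ) - z)).aestronglyMeasurable,
    ← neg_eq_iff_eq_neg.2 (h z hz), ← integral_neg]
  refine integral_congr_ae (.of_forall fun x => ?_)
  simp only [Complex.ofReal_neg]
  rw [← div_neg]
  ring_nf

/-- If the Stieltjes transform of `f dμ` is even and `μ` is even, then `f` is odd a.e. -/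
lemma ae_neg_eq_neg_of_stieltjes_even {μ : Measure ℝ} [IsFiniteMeasure μ]
    (hμ : MeasurePreserving (fun x : ℝ => -x) μ μ) {f : ℝ → ℂ} (hf : Integrable f μ)
    (h : ∀ z : ℂ, z.im ≠ 0 →
      ∫ x : ℝ, f x / ((x : ℂ) - -z) ∂μ = ∫ x : ℝ, f x / ((x : ℂ) - z) ∂μ) :
    ∀ᵐ x ∂μ, f (-x) = -f x := by
  have hemb : MeasurableEmbedding fun x : ℝ => -x := (MeasurableEquiv.neg ℝ).measurableEmbedding
  refine ae_eq_of_stieltjes_eq ((hμ.integrable_comp_emb hemb).2 hf) hf.neg fun z hz => ?_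
  have h1 := hμ.integral_comp hemb fun x : ℝ => f x / ((x : ℂ) - -z)
  rw [h z hz] at h1
  simp only [neg_div, integral_neg, ← h1]
  rw [← integral_neg]
  refine integral_congr_ae (.of_forall fun x => ?_)
  simp only [Complex.ofReal_neg]
  rw [← div_neg]
  ring_nf

/-- **Symmetric Weyl matrices come from symmetric matrix weights.**
Let `ρ` be a finite positive measure and `W` a Borel matrix density, positive semidefinite
with trace `1` a.e., and `∫ W dρ = I`. If the Stieltjes transform
`F(z) = ∫ W(x)/(x − z) dρ` satisfies `F(z)₀₀ = F(z)₁₁`, `F(−z)₀₀ = −F(z)₀₀`,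
`F(−z)₀₁ = F(z)₀₁`, `F(−z)₁₀ = F(z)₁₀`, then `W₀₀ = W₁₁ = 1/2` a.e., `|W₀₁| ≤ 1/2` a.e.,
`(1/2)ρ` is an even probability measure, and the complex measure `W₀₁ dρ` is odd. -/
theorem symmetric_weyl_matrix_structure
    (ρ : Measure ℝ) [IsFiniteMeasure ρ]
    (W : ℝ → Matrix (Fin 2) (Fin 2) ℂ)
    (hWmeas : ∀ (i j : Fin 2), Measurable fun x => W x i j)
    (hWpsd : ∀ᵐ x ∂ρ, (W x).PosSemidef ∧ (W x).trace = 1)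
    (htot : ∀ (i j : Fin 2), ∫ x, W x i j ∂ρ = (1 : Matrix (Fin 2) (Fin 2) ℂ) i j)
    (F : ℂ → Matrix (Fin 2) (Fin 2) ℂ)
    (hF : ∀ (z : ℂ) (i j : Fin 2), F z i j = ∫ x, W x i j / ((x : ℂ) - z) ∂ρ)
    (hsym : ∀ z : ℂ, z.im ≠ 0 →
      F z 0 0 = F z 1 1 ∧ F (-z) 0 0 = -(F z 0 0) ∧
      F (-z) 0 1 = F z 0 1 ∧ F (-z) 1 0 = F z 1 0) :
    (∀ᵐ x ∂ρ, W x 0 0 = 1 / 2 ∧ W x 1 1 = 1 / 2) ∧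
    (∀ᵐ x ∂ρ, ‖W x 0 1‖ ≤ 1 / 2) ∧
    (Measure.map (fun x => -x) ((1 / 2 : ℝ≥0∞) • ρ) = (1 / 2 : ℝ≥0∞) • ρ ∧
      IsProbabilityMeasure ((1 / 2 : ℝ≥0∞) • ρ)) ∧
    (∀ B : Set ℝ, MeasurableSet B →
      ∫ x in -B, W x 0 1 ∂ρ = -∫ x in B, W x 0 1 ∂ρ) := by
  have hint : ∀ i, Integrable (fun x => W x i i) ρ := fun i => by
    by_contra hi
    simpa [integral_undef hi] using htot i i
  have hdiag : ∀ᵐ x ∂ρ, W x 0 0 = 1 / 2 ∧ W x 1 1 = 1 / 2 := by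
    have heq := ae_eq_of_stieltjes_eq (hint 0) (hint 1) fun z hz => by
      rw [← hF, ← hF]
      exact (hsym z hz).1
    filter_upwards [heq, hWpsd] with x hx hp
    have htr := hp.2
    rw [Matrix.trace_fin_two] at htr
    constructor
    · linear_combination (1 / 2) * htr + (1 / 2) * hx
    · linear_combination (1 / 2) * htr - (1 / 2) * hx
  have hoff : ∀ᵐ x ∂ρ, ‖W x 0 1‖ ≤ 1 / 2 := by
    filter_upwards [hdiag, hWpsd] with x hx hp
    exact norm_apply_zero_one_le_half hp.1 hx.1 hx.2
  have hF00 : ∀ z, F z 0 0 = 1 / 2 * ∫ x : ℝ, 1 / ((x : ℂ) - z) ∂ρ := fun z => by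
    rw [hF, ← integral_const_mul]
    refine integral_congr_ae ?_
    filter_upwards [hdiag] with x hx
    rw [hx.1]
    ring
  have heven : ρ.map (fun x => -x) = ρ := map_neg_eq_of_stieltjes_odd fun z hz => by
    have h := (hsym z hz).2.1
    rw [hF00, hF00] at h
    linear_combination 2 * h
  have hmp : MeasurePreserving (fun x : ℝ => -x) ρ ρ := ⟨measurable_neg, heven⟩
  have hmass : ρ Set.univ = 2 := by
    have h := htot 0 0
    rw [integral_congr_ae (hdiag.mono fun x hx => hx.1), integral_const, Matrix.one_apply_eq,
      Complex.real_smul] at h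
    have h2 : ρ.real Set.univ = 2 := by
      have : (ρ.real Set.univ : ℂ) = 2 := by linear_combination 2 * h
      exact_mod_cast this
    rw [← ENNReal.ofReal_toReal (measure_ne_top ρ Set.univ), ← Measure.real, h2]
    simp
  refine ⟨hdiag, hoff, ⟨?_, ⟨?_⟩⟩, fun B hB => ?_⟩
  · rw [Measure.map_smul, heven]
  · rw [Measure.smul_apply, hmass, smul_eq_mul, one_div]
    exact ENNReal.inv_mul_cancel (by simp) (by simp)
  · have h01 : Integrable (fun x => W x 0 1) ρ :=
      Integrable.of_bound (hWmeas 0 1).aestronglyMeasurable (1 / 2) hoff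
    have hodd := ae_neg_eq_neg_of_stieltjes_even hmp h01 fun z hz => by
      rw [← hF, ← hF]
      exact (hsym z hz).2.2.1
    have hB' := hmp.setIntegral_preimage_emb (MeasurableEquiv.neg ℝ).measurableEmbedding
      (fun x => W x 0 1) (-B)
    have hpre : (fun x : ℝ => -x) ⁻¹' (-B) = B := by
      ext x
      simp
    rw [← hB', hpre, ← integral_neg]
    exact integral_congr_ae (ae_restrict_of_ae hodd)
end

section
/- Let ν_e and ν̃_e be even Borel probability measures on ℝ with ∫ |x|³ dν_e < ∞ and ∫ |x|³ dν̃_e < ∞, and let ψ_o, ψ̃_o : ℝ → ℂ be odd Borel functions with |ψ_o| ≤ 1 ν_e-a.e. and |ψ̃_o| ≤ 1 ν̃_e-a.e. Define F(z) = ∫ W(x)/(x − z) dν_e(x) where W(x) has diagonal entries 1 and off-diagonal entries ψ_o(x), conj(ψ_o(x)), and define F̃ analogously. Suppose there exist α > 0, a constant C > 0, and a sequence (z_j) with |z_j| → ∞ and arg(z_j) ∈ [α, π − α] such that ‖F(z_j) − F̃(z_j)‖ ≤ C|z_j|^{−4} for all j. Then ∫ x ψ_o(x) dν_e(x) = ∫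 x ψ̃_o(x) dν̃_e(x) and ∫ x² dν_e(x) = ∫ x² dν̃_e(x). -/
open MeasureTheory ComplexConjugate Real Matrix Filter

/-- Second-order expansion at infinity of a Stieltjes transform, with explicit remainder. -/
theorem norm_stieltjes_add_moments_le (ν : Measure ℝ) [IsProbabilityMeasure ν]
    (h3 : Integrable (fun x => |x| ^ 3) ν) {f : ℝ → ℂ} (hf : Measurable f)
    (hfb : ∀ᵐ x ∂ν, ‖f x‖ ≤ 1) {s : ℝ} (hs : 0 < s) {z : ℂ} (hz : z ≠ 0)
    (hzs : s * ‖z‖ ≤ z.im) :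
    ‖(∫ x, f x / ((x : ℂ) - z) ∂ν) + ((∫ x, f x ∂ν) * z⁻¹ + (∫ x, (x : ℂ) * f x ∂ν) * z⁻¹ ^ 2
      + (∫ x, (x : ℂ) ^ 2 * f x ∂ν) * z⁻¹ ^ 3)‖ ≤ (∫ x, |x| ^ 3 ∂ν) / s * ‖z⁻¹‖ ^ 4 := by
  have hzn : 0 < ‖z‖ := norm_pos_iff.mpr hz
  have hlow : ∀ x : ℝ, s * ‖z‖ ≤ ‖(x : ℂ) - z‖ := fun x => by
    refine hzs.trans ((le_abs_self _).trans ?_)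
    simpa using Complex.abs_im_le_norm ((x : ℂ) - z)
  have hne : ∀ x : ℝ, (x : ℂ) - z ≠ 0 := fun x =>
    norm_pos_iff.mp ((mul_pos hs hzn).trans_le (hlow x))
  have hdom : Integrable (fun x : ℝ => 1 + |x| ^ 3) ν := (integrable_const 1).add h3
  have hm : ∀ k ≤ 3, Integrable (fun x : ℝ => (x : ℂ) ^ k * f x) ν := fun k hk => by
    refine hdom.mono' (by fun_prop) ?_
    filter_upwards [hfb] with x hx
    have h1 : |x| ^ k ≤ 1 + |x| ^ 3 := by
      rcases le_total |x| 1 with h | h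
      · exact (pow_le_one₀ (abs_nonneg x) h).trans (by simp)
      · exact (pow_le_pow_right₀ h hk).trans (by simp)
    rw [norm_mul, norm_pow, Complex.norm_real, Real.norm_eq_abs]
    exact (mul_le_of_le_one_right (by positivity) hx).trans h1
  have hm0 : Integrable f ν := by simpa using hm 0 (by norm_num)
  have hm1 : Integrable (fun x : ℝ => (x : ℂ) * f x) ν := by simpa using hm 1 (by norm_num)
  have hm2 := hm 2 (by norm_num)
  have hq : Integrable (fun x : ℝ => f x / ((x : ℂ) - z)) ν := by
    refine (integrable_const (1 / (s * ‖z‖))).mono'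
      (show Measurable _ by fun_prop).aestronglyMeasurable ?_
    filter_upwards [hfb] with x hx
    rw [norm_div]
    exact div_le_div₀ zero_le_one hx (by positivity) (hlow x)
  have hr : ∀ x : ℝ, f x / ((x : ℂ) - z) + (f x * z⁻¹ + (x : ℂ) * f x * z⁻¹ ^ 2
      + (x : ℂ) ^ 2 * f x * z⁻¹ ^ 3) = (x : ℂ) ^ 3 * f x * z⁻¹ ^ 3 / ((x : ℂ) - z) := fun x => by
    have := hne x
    field_simp
    ring
  have hsum : (∫ x, f x / ((x : ℂ) - z) ∂ν) + ((∫ x, f x ∂ν) * z⁻¹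
      + (∫ x, (x : ℂ) * f x ∂ν) * z⁻¹ ^ 2 + (∫ x, (x : ℂ) ^ 2 * f x ∂ν) * z⁻¹ ^ 3)
      = ∫ x, (x : ℂ) ^ 3 * f x * z⁻¹ ^ 3 / ((x : ℂ) - z) ∂ν := by
    simp_rw [← hr, ← integral_mul_const]
    rw [← integral_add (hm0.mul_const _) (hm1.mul_const _),
      ← integral_add (by fun_prop) (hm2.mul_const _), ← integral_add hq (by fun_prop)]
  rw [hsum, div_mul_eq_mul_div, mul_div_assoc, ← integral_mul_const]
  refine norm_integral_le_of_norm_le (h3.mul_const _) ?_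
  filter_upwards [hfb] with x hx
  rw [norm_div, norm_mul, norm_mul, norm_pow, norm_pow, Complex.norm_real, Real.norm_eq_abs]
  calc |x| ^ 3 * ‖f x‖ * ‖z⁻¹‖ ^ 3 / ‖(x : ℂ) - z‖
      ≤ |x| ^ 3 * 1 * ‖z⁻¹‖ ^ 3 / (s * ‖z‖) := by gcongr; exact hlow x
    _ = |x| ^ 3 * (‖z⁻¹‖ ^ 4 / s) := by
      rw [norm_inv]
      field_simp

/-- A quadratic polynomial that is cubically small along a punctured null sequence vanishes. -/
theorem coeffs_eq_zero_of_norm_le_cube {w : ℕ → ℂ} (hw : Tendsto w atTop (nhds 0))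
    (hw0 : ∀ j, w j ≠ 0) {a b c : ℂ} {K : ℝ}
    (hb : ∀ j, ‖a + b * w j + c * w j ^ 2‖ ≤ K * ‖w j‖ ^ 3) : a = 0 ∧ b = 0 ∧ c = 0 := by
  have hn : Tendsto (fun j => ‖w j‖) atTop (nhds 0) := by simpa using hw.norm
  have hK : ∀ k ≠ 0, Tendsto (fun j => K * ‖w j‖ ^ k) atTop (nhds 0) := fun k hk => by
    simpa [hk] using (hn.pow k).const_mul K
  have lim : ∀ {d : ℂ} {g : ℕ → ℂ} {k : ℕ}, k ≠ 0 → Tendsto g atTop (nhds 0) →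
      (∀ j, ‖d + g j‖ ≤ K * ‖w j‖ ^ k) → d = 0 := fun {d g k} hk hg h => by
    have h1 : Tendsto (fun j => d + g j) atTop (nhds (d + 0)) := tendsto_const_nhds.add hg
    simpa using tendsto_nhds_unique h1 (squeeze_zero_norm h (hK k hk))
  have drop : ∀ {d : ℂ} {j k : ℕ}, ‖d * w j‖ ≤ K * ‖w j‖ ^ (k + 1) → ‖d‖ ≤ K * ‖w j‖ ^ k :=
    fun {d j k} h => by
      rw [norm_mul, pow_succ, ← mul_assoc] at h
      exact le_of_mul_le_mul_right h (norm_pos_iff.mpr (hw0 j))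
  have ha : a = 0 := lim (g := fun j => b * w j + c * w j ^ 2) three_ne_zero
    (by simpa using (hw.const_mul b).add ((hw.pow 2).const_mul c))
    fun j => by simpa [add_assoc] using hb j
  have hb' : ∀ j, ‖b + c * w j‖ ≤ K * ‖w j‖ ^ 2 := fun j => drop <| by
    convert hb j using 2
    rw [ha]; ring
  have hb0 : b = 0 := lim (g := fun j => c * w j) two_ne_zero (by simpa using hw.const_mul c) hb'
  have hc : ∀ j, ‖c + 0‖ ≤ K * ‖w j‖ ^ 1 := fun j => drop <| by
    convert hb' j using 2
    rw [hb0]; ring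
  exact ⟨ha, hb0, lim (g := fun _ => 0) one_ne_zero tendsto_const_nhds hc⟩

theorem sin_mul_norm_le_im {α : ℝ} (hα : 0 < α) {z : ℂ} (hz : z.arg ∈ Set.Icc α (π - α)) :
    sin α * ‖z‖ ≤ z.im := by
  rw [← Complex.norm_mul_sin_arg z, mul_comm]
  refine mul_le_mul_of_nonneg_left ?_ (norm_nonneg z)
  rcases le_total z.arg (π / 2) with h | h
  · exact sin_le_sin_of_le_of_le_pi_div_two (by linarith [pi_pos]) h hz.1
  · rw [← sin_pi_sub z.arg]
    exact sin_le_sin_of_le_of_le_pi_div_two (by linarith [pi_pos]) (by linarith)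
      (by linarith [hz.2])

/-- If two Stieltjes transforms agree to order `z⁻⁴` along a sequence tending to infinity
nontangentially, then their moments of order at most two coincide. -/
theorem moments_eq_of_stieltjes_sub_le (ν ν' : Measure ℝ) [IsProbabilityMeasure ν]
    [IsProbabilityMeasure ν'] (h3 : Integrable (fun x => |x| ^ 3) ν)
    (h3' : Integrable (fun x => |x| ^ 3) ν') {f f' : ℝ → ℂ} (hf : Measurable f)
    (hf' : Measurable f') (hfb : ∀ᵐ x ∂ν, ‖f x‖ ≤ 1) (hfb' : ∀ᵐ x ∂ν', ‖f' x‖ ≤ 1)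
    {s C : ℝ} (hs : 0 < s) {z : ℕ → ℂ} (hz : Tendsto (fun j => ‖z j‖) atTop atTop)
    (hz0 : ∀ j, z j ≠ 0) (hzs : ∀ j, s * ‖z j‖ ≤ (z j).im)
    (hC : ∀ j, ‖(∫ x, f x / ((x : ℂ) - z j) ∂ν) - ∫ x, f' x / ((x : ℂ) - z j) ∂ν'‖
      ≤ C / ‖z j‖ ^ 4) :
    (∫ x, f x ∂ν = ∫ x, f' x ∂ν') ∧ (∫ x, (x : ℂ) * f x ∂ν = ∫ x, (x : ℂ) * f' x ∂ν') ∧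
      (∫ x, (x : ℂ) ^ 2 * f x ∂ν = ∫ x, (x : ℂ) ^ 2 * f' x ∂ν') := by
  have hw : Tendsto (fun j => (z j)⁻¹) atTop (nhds 0) := by
    rw [tendsto_zero_iff_norm_tendsto_zero]
    simpa [Function.comp_def] using tendsto_inv_atTop_zero.comp hz
  simp only [← sub_eq_zero (b := ∫ x, f' x ∂ν'), ← sub_eq_zero (b := ∫ x, (x : ℂ) * f' x ∂ν'),
    ← sub_eq_zero (b := ∫ x, (x : ℂ) ^ 2 * f' x ∂ν')]
  refine coeffs_eq_zero_of_norm_le_cube hw (fun j => inv_ne_zero (hz0 j))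
    (K := (∫ x, |x| ^ 3 ∂ν) / s + (∫ x, |x| ^ 3 ∂ν') / s + C) fun j => ?_
  have e := norm_stieltjes_add_moments_le ν h3 hf hfb hs (hz0 j) (hzs j)
  have e' := norm_stieltjes_add_moments_le ν' h3' hf' hfb' hs (hz0 j) (hzs j)
  have hCj := hC j
  rw [div_eq_mul_inv, ← inv_pow, ← norm_inv] at hCj
  refine le_of_mul_le_mul_right ?_ (norm_pos_iff.mpr (inv_ne_zero (hz0 j)))
  rw [← norm_mul]
  refine le_trans (le_of_eq ?_) (((norm_sub_le _ _).trans
    (add_le_add ((norm_sub_le _ _).trans (add_le_add e e')) hCj)).trans (le_of_eq ?_))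
  · congr 1; ring
  · ring

theorem norm_apply_le_norm_toEuclideanCLM {n : Type*} [Fintype n] [DecidableEq n]
    (A : Matrix n n ℂ) (i j : n) : ‖A i j‖ ≤ ‖toEuclideanCLM (𝕜 := ℂ) A‖ := by
  have h := (toEuclideanCLM (𝕜 := ℂ) A).le_opNorm (EuclideanSpace.single j 1)
  have h' := PiLp.norm_apply_le (toEuclideanCLM (𝕜 := ℂ) A (EuclideanSpace.single j 1)) i
  simp at h h'
  exact h'.trans h

/-- **Asymptotic agreement of symmetric Weyl matrices along one nontangential sequence
forces agreement of the first two moments.** Let `(ν_e, ψ_o)` and `(ν̃_e, ψ̃_o)` be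
symmetric spectral data with finite third absolute moments, and let `F`, `F̃` be the
associated matrix Stieltjes transforms. If `‖F(z_j) − F̃(z_j)‖ ≤ C|z_j|⁻⁴` along a
sequence `z_j → ∞` with `arg z_j ∈ [α, π − α]`, then
`∫ x ψ_o dν_e = ∫ x ψ̃_o dν̃_e` and `∫ x² dν_e = ∫ x² dν̃_e`. -/
theorem symmetric_weyl_asymptotics_moments
    (ν ν' : Measure ℝ) [IsProbabilityMeasure ν] [IsProbabilityMeasure ν']
    (heven : ν.map (fun x => -x) = ν) (heven' : ν'.map (fun x => -x) = ν')
    (h3 : Integrable (fun x => |x| ^ 3) ν) (h3' : Integrable (fun x => |x| ^ 3) ν')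
    (ψ ψ' : ℝ → ℂ) (hψmeas : Measurable ψ) (hψ'meas : Measurable ψ')
    (hψodd : ∀ x, ψ (-x) = -ψ x) (hψ'odd : ∀ x, ψ' (-x) = -ψ' x)
    (hψb : ∀ᵐ x ∂ν, ‖ψ x‖ ≤ 1) (hψ'b : ∀ᵐ x ∂ν', ‖ψ' x‖ ≤ 1)
    (F F' : ℂ → Matrix (Fin 2) (Fin 2) ℂ)
    (hF : ∀ (z : ℂ) (i j : Fin 2),
      F z i j = ∫ x, (!![1, ψ x; conj (ψ x), 1]) i j / ((x : ℂ) - z) ∂ν)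
    (hF' : ∀ (z : ℂ) (i j : Fin 2),
      F' z i j = ∫ x, (!![1, ψ' x; conj (ψ' x), 1]) i j / ((x : ℂ) - z) ∂ν')
    (hyp : ∃ α > (0 : ℝ), ∃ C > (0 : ℝ), ∃ zseq : ℕ → ℂ,
      Tendsto (fun j => ‖zseq j‖) atTop atTop ∧
      (∀ j, (zseq j).arg ∈ Set.Icc α (π - α)) ∧
      (∀ j, ‖toEuclideanCLM (𝕜 := ℂ) (F (zseq j) - F' (zseq j))‖ ≤
        C / ‖zseq j‖ ^ 4)) :
    (∫ x, (x : ℂ) * ψ x ∂ν = ∫ x, (x : ℂ) * ψ' x ∂ν') ∧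
    (∫ x, x ^ 2 ∂ν = ∫ x, x ^ 2 ∂ν') := by
  obtain ⟨α, hα, C, -, z, hz, harg, hC⟩ := hyp
  have hs : 0 < sin α := sin_pos_of_pos_of_lt_pi hα (by linarith [(harg 0).1, (harg 0).2])
  have hz0 : ∀ j, z j ≠ 0 := fun j h => by
    have := (harg j).1
    rw [h, Complex.arg_zero] at this
    linarith
  have hzs := fun j => sin_mul_norm_le_im hα (harg j)
  have hent : ∀ i k j, ‖F (z j) i k - F' (z j) i k‖ ≤ C / ‖z j‖ ^ 4 := fun i k j =>
    (norm_apply_le_norm_toEuclideanCLM (F (z j) - F' (z j)) i k).trans (hC j)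
  simp only [hF, hF'] at hent
  refine ⟨(moments_eq_of_stieltjes_sub_le ν ν' h3 h3' hψmeas hψ'meas hψb hψ'b hs hz hz0 hzs
    (hent 0 1)).2.1, ?_⟩
  have h2 := (moments_eq_of_stieltjes_sub_le ν ν' h3 h3' (f := fun _ => 1) (f' := fun _ => 1)
    measurable_const measurable_const (by simp) (by simp) hs hz hz0 hzs (hent 0 0)).2.2
  simp only [mul_one, ← Complex.ofReal_pow, integral_complex_ofReal] at h2
  exact_mod_cast h2
end
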